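/- arXiv:1912.11763 — 2 statements merged into one kernel-verified Lean document; each statement's English description precedes it below -/
import Mathlib

section
/- Let n ≥ 3 and let ℓ = (ℓ_1,…,ℓ_n) ∈ ℤ^n with i ≤ ℓ_i ≤ 2n−1−i for i ≤ n−1 and n ≤ ℓ_n ≤ 2n−1. For 2 ≤ i ≤ n−1 and i+1 ≤ j ≤ 2n−1−i: if the procedure step ℓ → ℓ' is defined then α^{(ℓ)}_{i,j}(x_1,…,x_n) = α^{(ℓ')}_{i−1,j−1}(x_2,…,x_n), and if ℓ → ℓ' is not defined then α^{(ℓ)}_{i,j}(x_1,…,x_n) = α^{D_{n−1}}_{i−1,j−1}(x_2,…,x_n). For 2 ≤ r ≤ n−1: if ℓ → ℓ' is defined then α^{(ℓ)}_{n,2n−r}(x_1,…,x_n) = α^{(ℓ')}_{n−1,2(n−1)−(r−1)}(x_2,…,x_n), and if ℓ → ℓ' is not defined then α^{(ℓ)}_{n,2n−r}(x_1,…,x_n) = α^{D_{n−1}}_{n−1,2(n−1)−(r−1)}(x_2,…,x_n). Here α^{D_{n−1}}_{i,j}(x_2,…,x_n) denotes the type D_{n−1} root label in the variables x_2,…,x_n.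 -/
open MvPolynomial

noncomputable section

/-- The variable `x_k` (1-indexed) of `ℝ[x_1,…,x_n]`. -/
def xv (n : ℕ) (k : ℕ) : MvPolynomial (Fin n) ℝ :=
  if h : 1 ≤ k ∧ k ≤ n then X ⟨k - 1, by omega⟩ else 0

/-- The type `D_n` root label `α_{i,j}` with variables given by `x`. -/
def alD {R : Type*} [CommRing R] (x : ℕ → R) (n i j : ℕ) : R :=
  if i = n then x (2 * n - j) + x n
  else if j ≤ n then x i - x j
  else x i + x (2 * n - j)

/-- Labels of the steps of the reduction procedure on integer vectors. -/
inductive DLabel : Type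
  | r1 | r2 | r3
  deriving DecidableEq

/-- The label of the procedure step `ℓ → ℓ'`: `(1r)` if `ℓ_n < 2n−1` and `ℓ_1 ≤ n`;
`(3r)` if `ℓ_n < 2n−1` and `ℓ_1 ≥ n+1`; `(2r)` if `ℓ_n = 2n−1` and `ℓ_1 ≤ n−1`;
undefined (`none`) otherwise. -/
def dStepLabel (n : ℕ) (ℓ : ℕ → ℤ) : Option DLabel :=
  if ℓ n < 2 * (n : ℤ) - 1 then
    (if ℓ 1 ≤ (n : ℤ) then some DLabel.r1 else some DLabel.r3)
  else if ℓ 1 ≤ (n : ℤ) - 1 then some DLabel.r2 else none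

/-- The vector `ℓ' = (ℓ_2−1,…,ℓ_{n−1}−1, last)` produced by one procedure step, where the
last entry is `ℓ_1+n−2` if `ℓ_n = 2n−1` and `ℓ_n−1` otherwise. -/
def dStepVec (n : ℕ) (ℓ : ℕ → ℤ) : ℕ → ℤ := fun i =>
  if i = n - 1 then (if ℓ n = 2 * (n : ℤ) - 1 then ℓ 1 + (n : ℤ) - 2 else ℓ n - 1)
  else ℓ (i + 1) - 1

/-- `dStage n ℓ s` is the vector `ℓ^{(s+1)}` obtained by iterating the procedure `s` times
from `ℓ^{(1)} = ℓ`, or `none` if some step is undefined. -/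
def dStage (n : ℕ) (ℓ : ℕ → ℤ) : ℕ → Option (ℕ → ℤ)
  | 0 => some ℓ
  | s + 1 => (dStage n ℓ s).bind fun v =>
      if (dStepLabel (n - s) v).isSome then some (dStepVec (n - s) v) else none

/-- The label of the step `ℓ^{(s)} → ℓ^{(s+1)}` (1-based stage `s`), if defined. -/
def dLabelAt (n : ℕ) (ℓ : ℕ → ℤ) (s : ℕ) : Option DLabel :=
  (dStage n ℓ (s - 1)).bind fun v => dStepLabel (n - (s - 1)) v

/-- The modified root `α^{(ℓ)}_{i,j}` with variables given by `x`. -/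
def alDMod {R : Type*} [CommRing R] (x : ℕ → R) (n : ℕ) (ℓ : ℕ → ℤ) (i j : ℕ) : R :=
  if i = n then
    (if dLabelAt n ℓ (2 * n - j) = some DLabel.r3 then x (2 * n - j)
     else x (2 * n - j) + x n)
  else if i < n - j + i ∧ dLabelAt n ℓ i = some DLabel.r2 ∧
      dLabelAt n ℓ (n - j + i) = some DLabel.r3 then x (n - j + i)
  else if i < n - j + i ∧ dLabelAt n ℓ i = some DLabel.r2 ∧
      dLabelAt n ℓ (n - j + i) = some DLabel.r1 then x i - x (n - j + i)
  else alD x n i j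

theorem dStage_succ_of_isSome {n : ℕ} {ℓ : ℕ → ℤ} (h : (dStepLabel n ℓ).isSome) (s : ℕ) :
    dStage n ℓ (s + 1) = dStage (n - 1) (dStepVec n ℓ) s := by
  induction s with
  | zero => simp [dStage, h]
  | succ s ih =>
    rw [dStage, ih, dStage, show n - 1 - s = n - (s + 1) by omega]

theorem dStage_succ_of_not_isSome {n : ℕ} {ℓ : ℕ → ℤ} (h : ¬ (dStepLabel n ℓ).isSome) (s : ℕ) :
    dStage n ℓ (s + 1) = none := by
  induction s with
  | zero => simp [dStage, h]
  | succ s ih => rw [dStage, ih, Option.bind_none]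

theorem dLabelAt_of_isSome {n : ℕ} {ℓ : ℕ → ℤ} (h : (dStepLabel n ℓ).isSome) {s : ℕ}
    (hs : 2 ≤ s) : dLabelAt n ℓ s = dLabelAt (n - 1) (dStepVec n ℓ) (s - 1) := by
  obtain ⟨t, rfl⟩ := Nat.exists_eq_add_of_le' hs
  have hsub : n - 1 - t = n - (t + 1) := by omega
  simp [dLabelAt, dStage_succ_of_isSome h, hsub]

theorem dLabelAt_of_not_isSome {n : ℕ} {ℓ : ℕ → ℤ} (h : ¬ (dStepLabel n ℓ).isSome) {s : ℕ}
    (hs : 2 ≤ s) : dLabelAt n ℓ s = none := by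
  obtain ⟨t, rfl⟩ := Nat.exists_eq_add_of_le' hs
  simp [dLabelAt, dStage_succ_of_not_isSome h]

/-- Type `D` root labels are compatible with dropping the first variable. -/
theorem alD_shift {R : Type*} [CommRing R] (x : ℕ → R) {n i j : ℕ} (hi : 2 ≤ i) (hin : i ≤ n)
    (hj : 1 ≤ j) (hjn : j < 2 * n) :
    alD x n i j = alD (fun k => x (k + 1)) (n - 1) (i - 1) (j - 1) := by
  obtain ⟨i, rfl⟩ := Nat.exists_eq_add_of_le' hi
  obtain ⟨j, rfl⟩ := Nat.exists_eq_add_of_le' hj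
  obtain ⟨n, rfl⟩ := Nat.exists_eq_add_of_le' (show 1 ≤ n by omega)
  have hsub : 2 * (n + 1) - (j + 1) = 2 * n - j + 1 := by omega
  simp [alD, hsub]

/-- **Lemma 5.18.** For a vector `ℓ` with `i ≤ ℓ_i ≤ 2n−1−i` (`i ≤ n−1`) and
`n ≤ ℓ_n ≤ 2n−1`, the modified roots in the variables `x_1,…,x_n` agree with those of the
once-reduced data in the variables `x_2,…,x_n`: for `2 ≤ i ≤ n−1` and `i+1 ≤ j ≤ 2n−1−i`,
`α^{(ℓ)}_{i,j}(x_1,…,x_n)` equals `α^{(ℓ')}_{i−1,j−1}(x_2,…,x_n)` if the step `ℓ → ℓ'` is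
defined and `α^{D_{n−1}}_{i−1,j−1}(x_2,…,x_n)` otherwise; and for `2 ≤ r ≤ n−1`,
`α^{(ℓ)}_{n,2n−r}(x_1,…,x_n)` equals `α^{(ℓ')}_{n−1,2(n−1)−(r−1)}(x_2,…,x_n)` if the step
is defined and `α^{D_{n−1}}_{n−1,2(n−1)−(r−1)}(x_2,…,x_n)` otherwise. -/
theorem stmt_9 (n : ℕ) (hn : 3 ≤ n) (ℓ : ℕ → ℤ)
    (hl1 : ∀ i ∈ Finset.Icc 1 (n - 1), (i : ℤ) ≤ ℓ i ∧ ℓ i ≤ 2 * (n : ℤ) - 1 - (i : ℤ))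
    (hl2 : (n : ℤ) ≤ ℓ n ∧ ℓ n ≤ 2 * (n : ℤ) - 1) :
    (∀ i, 2 ≤ i → i ≤ n - 1 → ∀ j, i + 1 ≤ j → j ≤ 2 * n - 1 - i →
      ((dStepLabel n ℓ).isSome →
        alDMod (xv n) n ℓ i j =
          alDMod (fun k => xv n (k + 1)) (n - 1) (dStepVec n ℓ) (i - 1) (j - 1)) ∧
      (¬ (dStepLabel n ℓ).isSome →
        alDMod (xv n) n ℓ i j = alD (fun k => xv n (k + 1)) (n - 1) (i - 1) (j - 1))) ∧
    (∀ r, 2 ≤ r → r ≤ n - 1 →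
      ((dStepLabel n ℓ).isSome →
        alDMod (xv n) n ℓ n (2 * n - r) =
          alDMod (fun k => xv n (k + 1)) (n - 1) (dStepVec n ℓ) (n - 1)
            (2 * (n - 1) - (r - 1))) ∧
      (¬ (dStepLabel n ℓ).isSome →
        alDMod (xv n) n ℓ n (2 * n - r) =
          alD (fun k => xv n (k + 1)) (n - 1) (n - 1) (2 * (n - 1) - (r - 1)))) := by
  have hi_ne {i : ℕ} (hi : 2 ≤ i) (hin : i ≤ n - 1) : i ≠ n ∧ i - 1 ≠ n - 1 := by omega
  refine ⟨fun i hi hin j hij hj => ⟨fun h => ?_, fun h => ?_⟩,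
    fun r hr hrn => ⟨fun h => ?_, fun h => ?_⟩⟩
  · obtain ⟨hne, hne'⟩ := hi_ne hi hin
    have hk : n - 1 - (j - 1) + (i - 1) = n - j + i - 1 := by omega
    have hlt : i - 1 < n - j + i - 1 ↔ i < n - j + i := by omega
    rw [alDMod, alDMod, if_neg hne, if_neg hne', hk,
      ← dLabelAt_of_isSome h hi, ← dLabelAt_of_isSome h (show 2 ≤ n - j + i by omega),
      ← alD_shift (xv n) hi (by omega) (by omega) (by omega),
      Nat.sub_add_cancel (show 1 ≤ n - j + i by omega), Nat.sub_add_cancel (by omega)]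
    simp only [hlt]
  · obtain ⟨hne, -⟩ := hi_ne hi hin
    rw [alDMod, if_neg hne, dLabelAt_of_not_isSome h hi,
      ← alD_shift (xv n) hi (by omega) (by omega) (by omega)]
    simp
  · have hr₁ : 2 * n - (2 * n - r) = r := by omega
    have hr₂ : 2 * (n - 1) - (2 * (n - 1) - (r - 1)) = r - 1 := by omega
    rw [alDMod, alDMod, if_pos rfl, if_pos rfl, hr₁, hr₂, ← dLabelAt_of_isSome h hr,
      Nat.sub_add_cancel (by omega), Nat.sub_add_cancel (by omega)]
  · have hr₁ : 2 * n - (2 * n - r) = r := by omega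
    have hr₂ : 2 * (n - 1) - (r - 1) = 2 * n - r - 1 := by omega
    rw [hr₂, ← alD_shift (xv n) (by omega) le_rfl (by omega) (by omega), alDMod, alD,
      if_pos rfl, if_pos rfl, hr₁, dLabelAt_of_not_isSome h hr]
    simp
end
end

section
/- Let n ≥ 2, let d_i = (d_{i1},…,d_{ii},p_i) ∈ ℚ^{i+1} for 1 ≤ i ≤ n−1, let 1 ≤ j ≤ n, and assume R^{D_(n)}(j) is Artinian (finite dimensional over ℝ). Then multiplication by x_j induces a well-defined injective ℝ-linear map R^{D_(n)} → R^{D_(n)}(j), and its cokernel is isomorphic to R^{(B'_{(n−1)},D'_{(n−1)})}(j) in the variables x_1,…,x_{j−1},x_{j+1},…,x_n for some rational data B'_{(n−1)}, D'_{(n−1)}; that is, there is a short exact sequence 0 → R^{D_(n)} → R^{D_(n)}(j) → R^{(B'_{(n−1)},D'_{(n−1)})}(j) → 0. -/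
open MvPolynomial

noncomputable section

/-- `g^{b_i}_{i,2n+1−i} = Σ_{k=1}^{i} b_{ik}·(x_k²−x_{i+1}²)···(x_k²−x_n²)·x_k²`. -/
def gBsq (n : ℕ) (b : ℕ → ℕ → ℚ) (i : ℕ) : MvPolynomial (Fin n) ℝ :=
  ∑ k ∈ Finset.Icc 1 i,
    (b i k : ℝ) • ((∏ ℓ ∈ Finset.Icc (i + 1) n, (xv n k ^ 2 - xv n ℓ ^ 2)) * xv n k ^ 2)

/-- `f^{d_i}_{i,2n−1−i} = Σ_{k=1}^{i} d_{ik}·(x_k²−x_{i+1}²)···(x_k²−x_n²)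
 + (−1)^{n−i+1}·p_i·x_{i+1}²···x_n²` for `i ≥ 1`, with `f^{d_0}_{0,2n−1} = x_1²···x_n²`. -/
def fDd (n : ℕ) (d : ℕ → ℕ → ℚ) (p : ℕ → ℚ) (i : ℕ) : MvPolynomial (Fin n) ℝ :=
  if i = 0 then ∏ ℓ ∈ Finset.Icc 1 n, xv n ℓ ^ 2
  else
    (∑ k ∈ Finset.Icc 1 i,
        (d i k : ℝ) • ∏ ℓ ∈ Finset.Icc (i + 1) n, (xv n k ^ 2 - xv n ℓ ^ 2)) +
      ((-1 : ℝ) ^ (n - i + 1) * (p i : ℝ)) • ∏ ℓ ∈ Finset.Icc (i + 1) n, xv n ℓ ^ 2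

/-- The defining ideal of `R^{(B_(n),D_(n))}(j)`. -/
def IBD (n : ℕ) (b : ℕ → ℕ → ℚ) (d : ℕ → ℕ → ℚ) (p : ℕ → ℚ) (j : ℕ) :
    Ideal (MvPolynomial (Fin n) ℝ) :=
  Ideal.span
    ((fun i => gBsq n b i) '' Set.Icc 1 (j - 1) ∪
      (fun q => fDd n d p (q - 1)) '' Set.Icc j n)

/-- The defining ideal of `R^{D_(n)}`: generated by `f^{d_i}_{i,2n−1−i}` (`1 ≤ i ≤ n−1`)
together with `x_1···x_n`. -/
def IDn (n : ℕ) (d : ℕ → ℕ → ℚ) (p : ℕ → ℚ) : Ideal (MvPolynomial (Fin n) ℝ) :=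
  Ideal.span
    (insert (∏ ℓ ∈ Finset.Icc 1 n, xv n ℓ) ((fun i => fDd n d p i) '' Set.Icc 1 (n - 1)))

/-- The defining ideal of `R^{D_(n)}(j)`: generated by `f^{d_i}_{i,2n−1−i}` (`1 ≤ i ≤ n−1`)
together with `x_1···x_n·x_j`. -/
def IDnj (n : ℕ) (d : ℕ → ℕ → ℚ) (p : ℕ → ℚ) (j : ℕ) : Ideal (MvPolynomial (Fin n) ℝ) :=
  Ideal.span
    (insert ((∏ ℓ ∈ Finset.Icc 1 n, xv n ℓ) * xv n j)
      ((fun i => fDd n d p i) '' Set.Icc 1 (n - 1)))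

section LocalParameters

open IsLocalRing RingTheory.Sequence Ideal

variable {R : Type*} [CommRing R]

/-- Regularity of `r` modulo an ideal, spelled out in terms of membership. -/
lemma isSMulRegular_quotient_smul_top_iff (I : Ideal R) (r : R) :
    IsSMulRegular (R ⧸ (I • ⊤ : Submodule R R)) r ↔ ∀ g, r * g ∈ I → g ∈ I := by
  rw [isSMulRegular_iff_right_eq_zero_of_smul]
  have hI : (I • ⊤ : Submodule R R) = I := by simp
  constructor
  · intro h g hg
    have := h (Submodule.Quotient.mk g) (by
      rw [← Submodule.Quotient.mk_smul, Submodule.Quotient.mk_eq_zero, hI]; exact hg)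
    rwa [Submodule.Quotient.mk_eq_zero, hI] at this
  · intro h m
    obtain ⟨g, rfl⟩ := Submodule.Quotient.mk_surjective _ m
    rw [← Submodule.Quotient.mk_smul, Submodule.Quotient.mk_eq_zero, Submodule.Quotient.mk_eq_zero,
      hI]
    exact h g

lemma isWeaklyRegular_concat_iff (l : List R) (r : R) :
    IsWeaklyRegular R (l ++ [r]) ↔
      IsWeaklyRegular R l ∧ ∀ g, r * g ∈ ofList l → g ∈ ofList l := by
  rw [isWeaklyRegular_append_iff, isWeaklyRegular_singleton_iff,
    isSMulRegular_quotient_smul_top_iff]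

lemma ofList_perm {l l' : List R} (h : l.Perm l') : ofList l = ofList l' :=
  congrArg Ideal.span (Set.ext fun _ => h.mem_iff)

/-- The last term of a regular sequence may be exchanged for any element some multiple of which
is, modulo the previous terms, a power of the old one. -/
lemma RingTheory.Sequence.IsWeaklyRegular.exchange_last {l : List R} {a b : R}
    (h : IsWeaklyRegular R (l ++ [a]))
    (hab : a ∈ (ofList (l ++ [b])).radical) : IsWeaklyRegular R (l ++ [b]) := by
  rw [isWeaklyRegular_concat_iff] at h ⊢
  refine ⟨h.1, fun g hg => ?_⟩
  obtain ⟨N, hN⟩ := hab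
  rw [ofList_append, ofList_singleton, Submodule.mem_sup] at hN
  obtain ⟨u, hu, w, hw, huw⟩ := hN
  obtain ⟨v, rfl⟩ := Ideal.mem_span_singleton'.mp hw
  have key : a ^ N * g ∈ ofList l := by
    rw [← huw, add_mul, mul_assoc]
    exact add_mem (Ideal.mul_mem_right _ _ hu) (Ideal.mul_mem_left _ _ hg)
  clear huw
  induction N with
  | zero => simpa using key
  | succ N ih => exact ih (h.2 _ (by rwa [pow_succ', mul_assoc] at key))

variable [IsLocalRing R] [IsNoetherianRing R]

/-- If `l` can be completed by one element to a list generating an ideal primary to the maximal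
ideal, then it can be completed by any element of the maximal ideal outside the minimal primes
of `l`. -/
lemma maximalIdeal_le_radical_ofList_concat {l : List R} {x z : R}
    (hl : ∀ r ∈ l, r ∈ maximalIdeal R) (hx : x ∈ maximalIdeal R)
    (hrad : maximalIdeal R ≤ (ofList (l ++ [x])).radical)
    (hz : ∀ P ∈ (ofList l).minimalPrimes, z ∉ P) :
    maximalIdeal R ≤ (ofList (l ++ [z])).radical := by
  rw [Ideal.radical_eq_sInf]
  refine le_sInf fun P ⟨hP, hPp⟩ => ?_
  have hlP : {r | r ∈ l} ⊆ (P : Set R) := fun r hr =>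
    hP (Ideal.subset_span (List.mem_append_left [z] hr))
  have hzP : z ∈ P := hP (Ideal.subset_span (by simp))
  by_contra hne
  have hlt : P < maximalIdeal R :=
    lt_of_le_of_ne (le_maximalIdeal hPp.ne_top) (fun h => hne h.ge)
  have hset : insert x {r | r ∈ l} = {r | r ∈ l ++ [x]} := by
    ext r; simp [or_comm]
  refine hz P (Ideal.mem_minimalPrimes_span_of_mem_minimalPrimes_span_insert hlt x {r | r ∈ l} ?_
    {r | r ∈ l} hlP fun r hr => Ideal.le_radical (Ideal.subset_span (Or.inr hr))) hzP
  rw [hset]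
  refine ⟨⟨inferInstance, Ideal.span_le.mpr fun r hr => ?_⟩, fun Q ⟨hQ, hQl⟩ _ => ?_⟩
  · rcases List.mem_append.mp hr with hr | hr
    · exact hl r hr
    · rwa [List.mem_singleton.mp hr]
  · exact hrad.trans (hQ.radical_le_iff.mpr hQl)

/-- An element of the maximal ideal avoiding the minimal primes of two ideals, neither of which is
primary to the maximal ideal. -/
lemma exists_mem_maximalIdeal_notMem_minimalPrimes {I J : Ideal R}
    (hI : ¬ maximalIdeal R ≤ I.radical) (hJ : ¬ maximalIdeal R ≤ J.radical) :
    ∃ z ∈ maximalIdeal R, (∀ P ∈ I.minimalPrimes, z ∉ P) ∧ ∀ P ∈ J.minimalPrimes, z ∉ P := by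
  by_contra! hcon
  have hfin : (I.minimalPrimes ∪ J.minimalPrimes).Finite :=
    I.finite_minimalPrimes_of_isNoetherianRing.union J.finite_minimalPrimes_of_isNoetherianRing
  have hsub : (maximalIdeal R : Set R) ⊆ ⋃ P ∈ I.minimalPrimes ∪ J.minimalPrimes, (P : Set R) := by
    intro z hz
    by_cases h : ∀ P ∈ I.minimalPrimes, z ∉ P
    · obtain ⟨P, hP, hzP⟩ := hcon z hz h
      exact Set.mem_biUnion (Or.inr hP) hzP
    · push Not at h
      obtain ⟨P, hP, hzP⟩ := h
      exact Set.mem_biUnion (Or.inl hP) hzP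
  obtain ⟨P, hP, hle⟩ := (Ideal.subset_union_prime_finite (f := id) hfin ⊥ ⊥
    (fun P hP _ _ => hP.elim (fun h => h.1.1) (fun h => h.1.1))).mp hsub
  have aux : ∀ K : Ideal R, P ∈ K.minimalPrimes → maximalIdeal R ≤ K.radical := by
    intro K hK
    rw [Ideal.radical_eq_sInf]
    refine le_sInf fun Q ⟨hQ, hQp⟩ => ?_
    have hPm : P ≤ maximalIdeal R := le_maximalIdeal hK.1.1.ne_top
    obtain ⟨Q', hQ', hQ'Q⟩ := Ideal.exists_minimalPrimes_le hQ
    have : Q' ≤ P := (le_maximalIdeal hQ'.1.1.ne_top).trans hle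
    exact (hle.trans (hK.2 hQ'.1 this)).trans hQ'Q
  exact hP.elim (fun h => hI (aux I h)) (fun h => hJ (aux J h))

/-- In a Noetherian local ring in which fewer than `n` elements never generate an ideal primary to
the maximal ideal, all systems of parameters of length `n` are regular sequences as soon as one
is. -/
theorem isWeaklyRegular_of_isWeaklyRegular {n : ℕ}
    (hn : ∀ l : List R, (∀ r ∈ l, r ∈ maximalIdeal R) → l.length < n →
      ¬ maximalIdeal R ≤ (ofList l).radical)
    (k : ℕ) (zs xs ys : List R) (hxs : xs.length = k) (hys : ys.length = k)
    (hzs : zs.length + k = n)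
    (hx : ∀ r ∈ zs ++ xs, r ∈ maximalIdeal R) (hy : ∀ r ∈ zs ++ ys, r ∈ maximalIdeal R)
    (hxr : maximalIdeal R ≤ (ofList (zs ++ xs)).radical)
    (hyr : maximalIdeal R ≤ (ofList (zs ++ ys)).radical)
    (hreg : IsWeaklyRegular R (zs ++ xs)) : IsWeaklyRegular R (zs ++ ys) := by
  induction k generalizing zs xs ys with
  | zero =>
    obtain rfl := List.length_eq_zero_iff.mp hxs
    obtain rfl := List.length_eq_zero_iff.mp hys
    exact hreg
  | succ k ih =>
    obtain ⟨x, xs, rfl⟩ := List.exists_cons_of_length_eq_add_one hxs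
    obtain ⟨y, ys, rfl⟩ := List.exists_cons_of_length_eq_add_one hys
    simp only [List.length_cons, Nat.add_right_cancel_iff] at hxs hys
    have toEnd : ∀ (a : R) (as : List R), (zs ++ a :: as).Perm (zs ++ as ++ [a]) := fun a as => by
      rw [List.append_assoc]
      exact List.Perm.append_left _ (List.perm_append_singleton a as).symm
    have toMid : ∀ (a : R) (as : List R), (zs ++ as ++ [a]).Perm (zs ++ [a] ++ as) := fun a as => by
      rw [List.append_assoc, List.append_assoc]
      exact List.Perm.append_left _ List.perm_append_comm
    simp only [List.mem_append, List.mem_cons] at hx hy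
    have hx' : ∀ r ∈ zs ++ xs, r ∈ maximalIdeal R := fun r hr => hx r (by grind)
    have hy' : ∀ r ∈ zs ++ ys, r ∈ maximalIdeal R := fun r hr => hy r (by grind)
    obtain ⟨z, hzm, hzx, hzy⟩ := exists_mem_maximalIdeal_notMem_minimalPrimes
      (hn (zs ++ xs) hx' (by simp; omega)) (hn (zs ++ ys) hy' (by simp; omega))
    have hxm : x ∈ maximalIdeal R := hx x (by simp)
    have hym : y ∈ maximalIdeal R := hy y (by simp)
    rw [ofList_perm (toEnd x xs)] at hxr
    rw [ofList_perm (toEnd y ys)] at hyr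
    have hxz := maximalIdeal_le_radical_ofList_concat hx' hxm hxr hzx
    have hyz := maximalIdeal_le_radical_ofList_concat hy' hym hyr hzy
    have mem : ∀ (a : R) (as : List R), a ∈ maximalIdeal R →
        (∀ r ∈ zs ++ as, r ∈ maximalIdeal R) → ∀ r ∈ zs ++ as ++ [a], r ∈ maximalIdeal R := by
      intro a as ha has r hr
      rcases List.mem_append.mp hr with hr | hr
      · exact has r hr
      · rwa [List.mem_singleton.mp hr]
    have perm : ∀ {rs rs' : List R}, rs.Perm rs' → (∀ r ∈ rs, r ∈ maximalIdeal R) →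
        IsWeaklyRegular R rs → IsWeaklyRegular R rs' := fun h h' h'' =>
      isWeaklyRegular_of_perm_of_subset_maximalIdeal h'' h h'
    have h1 : IsWeaklyRegular R (zs ++ xs ++ [z]) :=
      (perm (toEnd x xs) (by simpa using hx) hreg).exchange_last (hxz hxm)
    have h2 : IsWeaklyRegular R (zs ++ [z] ++ ys) := by
      refine ih (zs ++ [z]) xs ys hxs hys (by simp; omega) ?_ ?_ ?_ ?_ ?_
      · exact fun r hr => mem z xs hzm hx' r ((toMid z xs).mem_iff.mpr hr)
      · exact fun r hr => mem z ys hzm hy' r ((toMid z ys).mem_iff.mpr hr)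
      · rwa [← ofList_perm (toMid z xs)]
      · rwa [← ofList_perm (toMid z ys)]
      · exact perm (toMid z xs) (mem z xs hzm hx') h1
    have h3 : IsWeaklyRegular R (zs ++ ys ++ [z]) :=
      perm (toMid z ys).symm (fun r hr => mem z ys hzm hy' r ((toMid z ys).mem_iff.mpr hr)) h2
    exact perm (toEnd y ys).symm (mem y ys hym hy') (h3.exchange_last (hyr hzm))

end LocalParameters

section PolynomialParameters

open IsLocalRing RingTheory.Sequence Ideal

variable {K : Type*} [Field K] {n : ℕ}

instance isMaximal_ker_constantCoeff :
    (RingHom.ker (constantCoeff : MvPolynomial (Fin n) K →+* K)).IsMaximal :=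
  RingHom.ker_isMaximal_of_surjective _ fun c => ⟨C c, constantCoeff_C _ c⟩

lemma ofList_X_eq_ker_constantCoeff :
    ofList ((List.finRange n).map (X : Fin n → MvPolynomial (Fin n) K)) =
      RingHom.ker (constantCoeff : MvPolynomial (Fin n) K →+* K) := by
  have hset : {r | r ∈ (List.finRange n).map (X : Fin n → MvPolynomial (Fin n) K)} =
      X '' Set.univ := by
    ext r; simp
  refine le_antisymm (Ideal.span_le.mpr ?_) fun f hf => ?_
  · rw [hset]
    rintro _ ⟨i, -, rfl⟩
    simp [RingHom.mem_ker]
  · rw [Ideal.ofList, hset, mem_ideal_span_X_image]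
    intro m hm
    by_contra! hcon
    obtain rfl : m = 0 := Finsupp.ext fun i => hcon i trivial
    exact mem_support_iff.mp hm hf

/-- The variables form a regular sequence in the polynomial ring. -/
lemma isWeaklyRegular_X :
    IsWeaklyRegular (MvPolynomial (Fin n) K)
      ((List.finRange n).map (X : Fin n → MvPolynomial (Fin n) K)) := by
  refine ⟨fun i hi => ?_⟩
  simp only [List.length_map, List.length_finRange] at hi
  rw [isSMulRegular_quotient_smul_top_iff]
  have hset : {r | r ∈ ((List.finRange n).map (X : Fin n → MvPolynomial (Fin n) K)).take i} =
      X '' {a : Fin n | a.1 < i} := by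
    ext r
    constructor
    · intro hr
      obtain ⟨a, ha, rfl⟩ := List.mem_take_iff_getElem.mp hr
      simp only [List.length_map, List.length_finRange, lt_inf_iff] at ha
      exact ⟨⟨a, ha.2⟩, ha.1, by simp⟩
    · rintro ⟨a, ha, rfl⟩
      refine List.mem_take_iff_getElem.mpr ⟨a.1, by simpa using ha, by simp⟩
  intro g hg
  simp only [List.getElem_map, List.getElem_finRange] at hg
  rw [Ideal.ofList, hset, mem_ideal_span_X_image] at hg ⊢
  intro m hm
  obtain ⟨a, ha, hma⟩ := hg (Finsupp.single ⟨i, hi⟩ 1 + m) (by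
    rw [mem_support_iff] at hm ⊢
    simpa [coeff_X_mul] using hm)
  refine ⟨a, ha, ?_⟩
  have hne : (⟨i, hi⟩ : Fin n) ≠ a := by
    rintro rfl
    exact lt_irrefl i ha
  simpa [Finsupp.single_apply, hne] using hma

/-- The local ring of affine `n`-space at the origin. -/
abbrev OriginLocalization (K : Type*) [Field K] (n : ℕ) : Type _ :=
  Localization.AtPrime (RingHom.ker (constantCoeff : MvPolynomial (Fin n) K →+* K))

lemma algebraMap_mem_maximalIdeal_origin {f : MvPolynomial (Fin n) K}
    (hf : constantCoeff f = 0) :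
    algebraMap _ (OriginLocalization K n) f ∈ maximalIdeal (OriginLocalization K n) :=
  (IsLocalization.AtPrime.to_map_mem_maximal_iff _
    (RingHom.ker (constantCoeff : MvPolynomial (Fin n) K →+* K)) f).mpr hf

lemma ofList_X_origin :
    ofList (((List.finRange n).map (X : Fin n → MvPolynomial (Fin n) K)).map
      (algebraMap _ (OriginLocalization K n))) = maximalIdeal (OriginLocalization K n) := by
  rw [← map_ofList, ofList_X_eq_ker_constantCoeff, Localization.AtPrime.map_eq_maximalIdeal]

lemma isRegular_X_origin :
    IsRegular (OriginLocalization K n)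
      (((List.finRange n).map (X : Fin n → MvPolynomial (Fin n) K)).map
        (algebraMap _ (OriginLocalization K n))) := by
  refine isWeaklyRegular_X.isRegular_of_isLocalization_of_mem (OriginLocalization K n)
    (RingHom.ker (constantCoeff : MvPolynomial (Fin n) K →+* K)) fun r hr => ?_
  obtain ⟨i, -, rfl⟩ := List.mem_map.mp hr
  simp [RingHom.mem_ker]

lemma height_maximalIdeal_origin : (maximalIdeal (OriginLocalization K n)).height = n := by
  have h := ringKrullDim_add_length_eq_ringKrullDim_of_isRegular _
    (isRegular_X_origin (K := K) (n := n))
  rw [ofList_X_origin, ← maximalIdeal_height_eq_ringKrullDim] at h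
  have h0 : ringKrullDim (OriginLocalization K n ⧸ maximalIdeal (OriginLocalization K n)) = 0 :=
    ringKrullDim_eq_zero_of_isField
      ((Ideal.Quotient.maximal_ideal_iff_isField_quotient _).mp inferInstance)
  rw [h0] at h
  simp only [List.length_map, List.length_finRange, zero_add] at h
  exact_mod_cast h.symm

/-- Fewer than `n` elements do not cut out the origin of affine `n`-space. -/
lemma not_maximalIdeal_origin_le_radical (l : List (OriginLocalization K n))
    (hl : ∀ r ∈ l, r ∈ maximalIdeal (OriginLocalization K n)) (hlen : l.length < n) :
    ¬ maximalIdeal (OriginLocalization K n) ≤ (ofList l).radical := by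
  classical
  intro h
  have hfin : ({r | r ∈ l} : Set (OriginLocalization K n)) = (l.toFinset : Set _) := by
    ext r; simp
  have hmin : maximalIdeal (OriginLocalization K n) ∈
      (Ideal.span (l.toFinset : Set (OriginLocalization K n))).minimalPrimes := by
    rw [← hfin]
    exact ⟨⟨inferInstance, Ideal.span_le.mpr hl⟩,
      fun Q ⟨hQ, hQl⟩ _ => h.trans (hQ.radical_le_iff.mpr hQl)⟩
  have hcard := Ideal.height_le_card_of_mem_minimalPrimes_span_finset hmin
  rw [height_maximalIdeal_origin, Nat.cast_le] at hcard
  exact absurd (hcard.trans l.toFinset_card_le) (by omega)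

lemma maximalIdeal_origin_le_radical_map (I : Ideal (MvPolynomial (Fin n) K))
    [FiniteDimensional K (MvPolynomial (Fin n) K ⧸ I)] :
    maximalIdeal (OriginLocalization K n) ≤
      (I.map (algebraMap _ (OriginLocalization K n))).radical := by
  set M := RingHom.ker (constantCoeff : MvPolynomial (Fin n) K →+* K)
  rw [Ideal.radical_eq_sInf]
  refine le_sInf fun P ⟨hP, hPp⟩ => ?_
  have hIP : I ≤ P.comap (algebraMap _ (OriginLocalization K n)) := Ideal.map_le_iff_le_comap.mp hP
  have hart : IsArtinianRing (MvPolynomial (Fin n) K ⧸ I) := IsArtinianRing.of_finite K _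
  set Q := P.comap (algebraMap (MvPolynomial (Fin n) K) (OriginLocalization K n)) with hQ
  have hQp : Q.IsPrime := hPp.comap _
  have hQmax : Q.IsMaximal := by
    have hprime : (Q.map (Ideal.Quotient.mk I)).IsPrime :=
      Ideal.map_isPrime_of_surjective Ideal.Quotient.mk_surjective (by rwa [Ideal.mk_ker])
    have hmax := IsArtinianRing.isMaximal_of_isPrime (Q.map (Ideal.Quotient.mk I))
    have := Ideal.comap_isMaximal_of_surjective (Ideal.Quotient.mk I)
      Ideal.Quotient.mk_surjective (K := Q.map (Ideal.Quotient.mk I))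
    rwa [Ideal.comap_map_of_surjective _ Ideal.Quotient.mk_surjective,
      ← RingHom.ker_eq_comap_bot, Ideal.mk_ker, sup_eq_left.mpr hIP] at this
  have hQM : Q ≤ M := by
    rw [hQ, ← Localization.AtPrime.under_maximalIdeal (I := M)]
    exact Ideal.comap_mono (le_maximalIdeal hPp.ne_top)
  have hQM' : Q = M := hQmax.eq_of_le (isMaximal_ker_constantCoeff).ne_top hQM
  rw [← Localization.AtPrime.map_eq_maximalIdeal, Ideal.map_le_iff_le_comap]
  exact hQM'.ge

/-- A quotient of the polynomial ring in `n` variables by fewer than `n` polynomials without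
constant term is infinite dimensional. -/
theorem not_finiteDimensional_quotient_ofList (l : List (MvPolynomial (Fin n) K))
    (hl : ∀ f ∈ l, constantCoeff f = 0) (hlen : l.length < n) :
    ¬ FiniteDimensional K (MvPolynomial (Fin n) K ⧸ ofList l) := by
  intro hfin
  have := maximalIdeal_origin_le_radical_map (ofList l)
  rw [map_ofList] at this
  refine not_maximalIdeal_origin_le_radical _ (fun r hr => ?_) (by simpa using hlen) this
  obtain ⟨f, hf, rfl⟩ := List.mem_map.mp hr
  exact algebraMap_mem_maximalIdeal_origin (hl f hf)

lemma homogeneousComponent_mem_ofList {l : List (MvPolynomial (Fin n) K)}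
    (hl : ∀ f ∈ l, ∃ k, f.IsHomogeneous k) {f : MvPolynomial (Fin n) K} (hf : f ∈ ofList l)
    (k : ℕ) : homogeneousComponent k f ∈ ofList l := by
  let _ : GradedAlgebra (homogeneousSubmodule (Fin n) K) := gradedAlgebra
  exact (mem_iff_homogeneousComponent_mem (Ideal.homogeneous_span _ _ hl) f).mp hf k

/-- Polynomials with non-zero constant term are regular modulo homogeneous ideals. -/
lemma mem_of_mul_mem_of_constantCoeff_ne_zero {I : Ideal (MvPolynomial (Fin n) K)}
    (hI : ∀ f ∈ I, ∀ k, homogeneousComponent k f ∈ I) {s g : MvPolynomial (Fin n) K}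
    (hs : constantCoeff s ≠ 0) (hg : s * g ∈ I) : g ∈ I := by
  set t := 1 - C (constantCoeff s)⁻¹ * s with ht
  have ht0 : t ∈ idealOfVars (Fin n) K := by
    rw [← pow_one (idealOfVars (Fin n) K), mem_pow_idealOfVars_iff']
    intro x hx
    obtain rfl : x = 0 := by
      rw [← Finsupp.degree_eq_zero_iff]; omega
    have : constantCoeff t = 0 := by simp [ht, hs]
    exact this
  have hstep : ∀ N : ℕ, g - t ^ N * g ∈ I := by
    intro N
    induction N with
    | zero => simp
    | succ N ih =>
      have : g - t ^ (N + 1) * g = (g - t ^ N * g) + t ^ N * C (constantCoeff s)⁻¹ * (s * g) := by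
        rw [ht]; ring
      rw [this]
      exact add_mem ih (Ideal.mul_mem_left _ _ hg)
  rw [← sum_homogeneousComponent g]
  refine Ideal.sum_mem _ fun k _ => ?_
  have hk : homogeneousComponent k (t ^ (k + 1) * g) = 0 := by
    have hmem : t ^ (k + 1) * g ∈ idealOfVars (Fin n) K ^ (k + 1) :=
      Ideal.mul_mem_right _ _ (Ideal.pow_mem_pow ht0 _)
    rw [mem_pow_idealOfVars_iff'] at hmem
    ext x
    rw [coeff_homogeneousComponent, coeff_zero]
    split_ifs with hx
    · exact hmem x (by omega)
    · rfl
  simpa [hk] using hI _ (hstep (k + 1)) k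

/-- Let `l` be `n - 1` homogeneous polynomials without constant term in `n` variables. If `F` has
no constant term and the quotient by `l` and `F` is finite dimensional, then `F` is regular modulo
the ideal generated by `l`. -/
theorem mem_ofList_of_mul_mem (l : List (MvPolynomial (Fin n) K)) (F : MvPolynomial (Fin n) K)
    (hlen : l.length + 1 = n) (hhom : ∀ f ∈ l, ∃ k, f.IsHomogeneous k)
    (hl : ∀ f ∈ l, constantCoeff f = 0) (hF : constantCoeff F = 0)
    (hfin : FiniteDimensional K (MvPolynomial (Fin n) K ⧸ ofList (l ++ [F])))
    {g : MvPolynomial (Fin n) K} (hg : F * g ∈ ofList l) : g ∈ ofList l := by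
  set ι := algebraMap (MvPolynomial (Fin n) K) (OriginLocalization K n) with hι
  have hmem : ∀ f ∈ l ++ [F], constantCoeff f = 0 := by
    intro f hf
    rcases List.mem_append.mp hf with hf | hf
    · exact hl f hf
    · rwa [List.mem_singleton.mp hf]
  have hreg : IsWeaklyRegular (OriginLocalization K n) ([] ++ (l ++ [F]).map ι) := by
    refine isWeaklyRegular_of_isWeaklyRegular not_maximalIdeal_origin_le_radical n []
      (((List.finRange n).map (X : Fin n → MvPolynomial (Fin n) K)).map ι) ((l ++ [F]).map ι)
      (by simp) (by simpa using hlen) (by simp) ?_ ?_ ?_ ?_ ?_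
    · rw [List.nil_append, ← ofList_X_origin]
      exact fun r hr => Ideal.subset_span hr
    · intro r hr
      obtain ⟨f, hf, rfl⟩ := List.mem_map.mp hr
      exact algebraMap_mem_maximalIdeal_origin (hmem f hf)
    · rw [List.nil_append, ofList_X_origin]
      exact Ideal.le_radical
    · rw [List.nil_append, ← map_ofList]
      exact maximalIdeal_origin_le_radical_map _
    · exact isRegular_X_origin.toIsWeaklyRegular
  rw [List.nil_append, List.map_append, List.map_singleton, isWeaklyRegular_concat_iff,
    ← map_ofList] at hreg
  have hgS : ι g ∈ (ofList l).map ι :=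
    hreg.2 _ (by rw [← map_mul]; exact Ideal.mem_map_of_mem _ hg)
  obtain ⟨s, hs, hsg⟩ := (IsLocalization.algebraMap_mem_map_algebraMap_iff
    (RingHom.ker (constantCoeff : MvPolynomial (Fin n) K →+* K)).primeCompl _ _ _).mp hgS
  exact mem_of_mul_mem_of_constantCoeff_ne_zero
    (fun f hf => homogeneousComponent_mem_ofList hhom hf) hs hsg

end PolynomialParameters

section DropVariable

lemma xv_isHomogeneous (n k : ℕ) : (xv n k).IsHomogeneous 1 := by
  unfold xv
  split_ifs
  · exact isHomogeneous_X _ _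
  · exact isHomogeneous_zero _ _ _

lemma fDd_isHomogeneous {n i : ℕ} (d : ℕ → ℕ → ℚ) (p : ℕ → ℚ) (hi : 1 ≤ i) :
    (fDd n d p i).IsHomogeneous (∑ _ℓ ∈ Finset.Icc (i + 1) n, 2) := by
  have hsq : ∀ k, (xv n k ^ 2).IsHomogeneous 2 := fun k => (xv_isHomogeneous n k).pow 2
  have hsmul : ∀ {m : ℕ} (c : ℝ) {f : MvPolynomial (Fin n) ℝ}, f.IsHomogeneous m →
      (c • f).IsHomogeneous m := fun c f hf => Submodule.smul_mem (homogeneousSubmodule _ _ _) c hf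
  rw [fDd, if_neg (by omega)]
  refine IsHomogeneous.add (IsHomogeneous.sum _ _ _ fun k _ => hsmul _ ?_) (hsmul _ ?_)
  · exact IsHomogeneous.prod _ _ _ fun ℓ _ => (hsq k).sub (hsq ℓ)
  · exact IsHomogeneous.prod _ _ _ fun ℓ _ => hsq ℓ

lemma constantCoeff_xv (n k : ℕ) : constantCoeff (xv n k) = 0 := by
  unfold xv
  split_ifs <;> simp

lemma constantCoeff_fDd {n i : ℕ} (d : ℕ → ℕ → ℚ) (p : ℕ → ℚ) (hi : 1 ≤ i) (hin : i < n) :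
    constantCoeff (fDd n d p i) = 0 := by
  refine (fDd_isHomogeneous d p hi).coeff_eq_zero ?_
  simp only [map_zero, Finset.sum_const, Nat.card_Icc, smul_eq_mul]
  omega

/-- A product over an interval, with the factor of index `j` split off and the later indices
shifted. -/
@[to_additive]
lemma prod_Icc_eq_prod_skip_mul {M : Type*} [CommMonoid M] (G : ℕ → M) {a j n : ℕ} (haj : a ≤ j)
    (hj : 1 ≤ j) (hjn : j ≤ n) :
    ∏ k ∈ Finset.Icc a n, G k =
      (∏ k ∈ Finset.Icc a (n - 1), G (if k < j then k else k + 1)) * G j := by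
  obtain ⟨n, rfl⟩ : ∃ m, n = m + 1 := ⟨n - 1, by omega⟩
  have hIco : ∀ m, Finset.Icc a m = Finset.Ico a (m + 1) := fun m => by ext; simp
  rw [Nat.add_sub_cancel, hIco, hIco,
    ← Finset.prod_Ico_consecutive _ haj (show j ≤ n + 1 + 1 by omega),
    ← Finset.prod_Ico_consecutive _ haj (show j ≤ n + 1 by omega),
    Finset.prod_eq_prod_Ico_succ_bot (show j < n + 1 + 1 by omega), mul_assoc, mul_comm (G j)]
  congr 1
  · refine Finset.prod_congr rfl fun k hk => ?_
    rw [if_pos (Finset.mem_Ico.mp hk).2]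
  · congr 1
    rw [← Finset.prod_Ico_add' G j (n + 1) 1]
    refine Finset.prod_congr rfl fun k hk => ?_
    rw [if_neg (by have := (Finset.mem_Ico.mp hk).1; omega)]

/-- Setting `x_j = 0` and renumbering the remaining variables. -/
def dropVar (n j : ℕ) : MvPolynomial (Fin n) ℝ →ₐ[ℝ] MvPolynomial (Fin (n - 1)) ℝ :=
  aeval fun i => if i.1 + 1 < j then xv (n - 1) (i.1 + 1) else
    if i.1 + 1 = j then 0 else xv (n - 1) i.1

/-- The inclusion of the polynomials not involving `x_j`. -/
def skipVar (n j : ℕ) : MvPolynomial (Fin (n - 1)) ℝ →ₐ[ℝ] MvPolynomial (Fin n) ℝ :=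
  aeval fun i => xv n (if i.1 + 1 < j then i.1 + 1 else i.1 + 1 + 1)

variable {n j : ℕ}

lemma X_eq_xv (i : Fin n) : (X i : MvPolynomial (Fin n) ℝ) = xv n (i.1 + 1) := by
  have := i.2
  rw [xv, dif_pos (by omega)]
  rfl

lemma dropVar_xv_self : dropVar n j (xv n j) = 0 := by
  unfold xv
  split_ifs with h
  · rw [dropVar, aeval_X, if_neg (by simp; omega), if_pos (by simp; omega)]
  · exact map_zero _

lemma dropVar_xv_skip (hj : 1 ≤ j) (hjn : j ≤ n) (k : ℕ) :
    dropVar n j (xv n (if k < j then k else k + 1)) = xv (n - 1) k := by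
  split_ifs with hk
  · by_cases h : 1 ≤ k
    · rw [xv, dif_pos (by omega), dropVar, aeval_X]
      simp only
      rw [if_pos (by omega), Nat.sub_add_cancel h]
    · rw [xv, dif_neg (by omega), xv, dif_neg (by omega), map_zero]
  · by_cases h : k + 1 ≤ n
    · rw [xv, dif_pos (by omega), dropVar, aeval_X]
      simp only
      rw [if_neg (by omega), if_neg (by omega), Nat.add_sub_cancel]
    · rw [xv, dif_neg (by omega), xv, dif_neg (by omega), map_zero]

lemma skipVar_xv {k : ℕ} (hk : 1 ≤ k) (hkn : k ≤ n - 1) :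
    skipVar n j (xv (n - 1) k) = xv n (if k < j then k else k + 1) := by
  rw [xv, dif_pos (by omega), skipVar, aeval_X]
  simp only [Nat.sub_add_cancel hk]

lemma dropVar_skipVar (hj : 1 ≤ j) (hjn : j ≤ n) (g : MvPolynomial (Fin (n - 1)) ℝ) :
    dropVar n j (skipVar n j g) = g := by
  have h : (dropVar n j).comp (skipVar n j) = AlgHom.id ℝ _ := by
    ext1 i
    simp only [AlgHom.comp_apply, skipVar, aeval_X, AlgHom.id_apply]
    rw [dropVar_xv_skip hj hjn, X_eq_xv]
  exact DFunLike.congr_fun h g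

lemma skipVar_dropVar_sub_mem (hj : 1 ≤ j) (hjn : j ≤ n) (g : MvPolynomial (Fin n) ℝ) :
    skipVar n j (dropVar n j g) - g ∈ Ideal.span {xv n j} := by
  have h : ((Ideal.Quotient.mkₐ ℝ (Ideal.span {xv n j})).comp (skipVar n j)).comp (dropVar n j) =
      Ideal.Quotient.mkₐ ℝ (Ideal.span {xv n j}) := by
    ext1 i
    have hi := i.2
    simp only [AlgHom.comp_apply, dropVar, aeval_X, Ideal.Quotient.mkₐ_eq_mk]
    rw [X_eq_xv]
    split_ifs with h1 h2
    · rw [skipVar_xv (by omega) (by omega), if_pos h1]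
    · rw [map_zero, map_zero, eq_comm, Ideal.Quotient.eq_zero_iff_mem, h2]
      exact Ideal.mem_span_singleton_self _
    · rw [skipVar_xv (by omega) (by omega), if_neg (by omega)]
  exact Ideal.Quotient.eq.mp (DFunLike.congr_fun h g)

lemma dropVar_eq_zero_iff (hj : 1 ≤ j) (hjn : j ≤ n) {g : MvPolynomial (Fin n) ℝ} :
    dropVar n j g = 0 ↔ g ∈ Ideal.span {xv n j} := by
  constructor
  · intro h
    have := skipVar_dropVar_sub_mem hj hjn g
    rwa [h, map_zero, zero_sub, neg_mem_iff] at this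
  · intro h
    obtain ⟨a, rfl⟩ := Ideal.mem_span_singleton'.mp h
    rw [map_mul, dropVar_xv_self, mul_zero]

lemma dropVar_fDd_of_lt (d : ℕ → ℕ → ℚ) (p : ℕ → ℚ) {i : ℕ} (hi : 1 ≤ i) (hij : i < j)
    (hjn : j ≤ n) : dropVar n j (fDd n d p i) = gBsq (n - 1) d i := by
  have hj : 1 ≤ j := by omega
  rw [fDd, if_neg (by omega), gBsq]
  simp only [map_add, map_sum, map_smul, map_prod, map_sub, map_pow]
  rw [prod_Icc_eq_prod_skip_mul (fun ℓ => dropVar n j (xv n ℓ) ^ 2) hij hj hjn]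
  simp only [dropVar_xv_self]
  rw [zero_pow two_ne_zero, mul_zero, smul_zero, add_zero]
  refine Finset.sum_congr rfl fun k hk => ?_
  have hkj : k < j := (Finset.mem_Icc.mp hk).2.trans_lt hij
  have hxk := dropVar_xv_skip hj hjn k
  rw [if_pos hkj] at hxk
  rw [prod_Icc_eq_prod_skip_mul (fun ℓ => dropVar n j (xv n k) ^ 2 - dropVar n j (xv n ℓ) ^ 2)
    hij hj hjn]
  simp only [dropVar_xv_self, dropVar_xv_skip hj hjn, hxk]
  rw [zero_pow two_ne_zero, sub_zero]

/-- The coefficients `d'` obtained by setting `x_j = 0`. -/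
def dropCoeff (d : ℕ → ℕ → ℚ) (j i k : ℕ) : ℚ := d (i + 1) (if k < j then k else k + 1)

/-- The coefficients `p'` obtained by setting `x_j = 0`. -/
def dropLast (d : ℕ → ℕ → ℚ) (p : ℕ → ℚ) (j i : ℕ) : ℚ := p (i + 1) - d (i + 1) j

lemma dropVar_fDd_succ (d : ℕ → ℕ → ℚ) (p : ℕ → ℚ) {i : ℕ} (hj : 1 ≤ j) (hij : j ≤ i + 1)
    (hin : i + 1 < n) :
    dropVar n j (fDd n d p (i + 1)) =
      (∑ k ∈ Finset.Icc 1 i, (dropCoeff d j i k : ℝ) •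
        ∏ ℓ ∈ Finset.Icc (i + 1) (n - 1), (xv (n - 1) k ^ 2 - xv (n - 1) ℓ ^ 2)) +
      ((-1 : ℝ) ^ (n - 1 - i + 1) * (dropLast d p j i : ℝ)) •
        ∏ ℓ ∈ Finset.Icc (i + 1) (n - 1), xv (n - 1) ℓ ^ 2 := by
  have hjn : j ≤ n := by omega
  have hshift : ∀ G : MvPolynomial (Fin (n - 1)) ℝ → MvPolynomial (Fin (n - 1)) ℝ,
      ∏ ℓ ∈ Finset.Icc (i + 1 + 1) n, G (dropVar n j (xv n ℓ)) =
        ∏ ℓ ∈ Finset.Icc (i + 1) (n - 1), G (xv (n - 1) ℓ) := by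
    intro G
    refine (Finset.prod_nbij (· + 1) (fun ℓ hℓ => ?_) (fun _ _ _ _ h => Nat.succ_injective h)
      (fun ℓ hℓ => ?_) (fun ℓ hℓ => ?_)).symm
    · simp only [Finset.mem_Icc] at hℓ ⊢
      omega
    · simp only [Finset.coe_Icc, Set.mem_Icc, Set.mem_image] at hℓ ⊢
      exact ⟨ℓ - 1, by omega, by omega⟩
    · have hx := dropVar_xv_skip hj hjn ℓ
      rw [if_neg (by have := (Finset.mem_Icc.mp hℓ).1; omega)] at hx
      rw [hx]
  have hzero : ∏ ℓ ∈ Finset.Icc (i + 1) (n - 1), (0 - xv (n - 1) ℓ ^ 2) =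
      ((-1 : ℝ) ^ (n - 1 - i)) • ∏ ℓ ∈ Finset.Icc (i + 1) (n - 1), xv (n - 1) ℓ ^ 2 := by
    simp only [zero_sub]
    rw [Finset.prod_neg, Nat.card_Icc, Nat.add_sub_add_right, smul_eq_C_mul]
    simp
  rw [fDd, if_neg (by omega)]
  simp only [map_add, map_sum, map_smul, map_prod, map_sub, map_pow]
  rw [hshift (fun y => y ^ 2)]
  simp only [fun k => hshift (fun y => dropVar n j (xv n k) ^ 2 - y ^ 2)]
  rw [sum_Icc_eq_sum_skip_add _ hj hj hij, dropVar_xv_self, zero_pow two_ne_zero, hzero,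
    Nat.add_sub_cancel, add_assoc]
  simp only [dropVar_xv_skip hj hjn]
  congr 1
  rw [smul_smul, ← add_smul, dropLast]
  congr 1
  rw [show n - (i + 1) + 1 = n - 1 - i + 1 by omega]
  push_cast
  ring

end DropVariable

section ExactSequence

variable {n j : ℕ} (d : ℕ → ℕ → ℚ) (p : ℕ → ℚ)

/-- The generators `f_1, …, f_{n-1}` as a list. -/
def fList (n : ℕ) (d : ℕ → ℕ → ℚ) (p : ℕ → ℚ) : List (MvPolynomial (Fin n) ℝ) :=
  (List.range' 1 (n - 1)).map (fDd n d p)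

lemma mem_fList {f : MvPolynomial (Fin n) ℝ} :
    f ∈ fList n d p ↔ ∃ i, (1 ≤ i ∧ i < n) ∧ fDd n d p i = f := by
  simp only [fList, List.mem_map, List.mem_range'_1]
  exact exists_congr fun i => and_congr_left fun _ => by omega

lemma ofList_fList :
    Ideal.ofList (fList n d p) = Ideal.span ((fun i => fDd n d p i) '' Set.Icc 1 (n - 1)) := by
  rw [Ideal.ofList]
  congr 1
  ext f
  simp only [Set.mem_ofPred_eq, mem_fList, Set.mem_image, Set.mem_Icc]
  exact exists_congr fun i => and_congr_left fun _ => by omega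

lemma IDn_eq_sup :
    IDn n d p = Ideal.span {∏ ℓ ∈ Finset.Icc 1 n, xv n ℓ} ⊔ Ideal.ofList (fList n d p) := by
  rw [IDn, Ideal.span_insert, ofList_fList]

lemma IDnj_eq_sup :
    IDnj n d p j = Ideal.span {(∏ ℓ ∈ Finset.Icc 1 n, xv n ℓ) * xv n j} ⊔
      Ideal.ofList (fList n d p) := by
  rw [IDnj, Ideal.span_insert, ofList_fList]

lemma IDnj_eq_ofList :
    IDnj n d p j =
      Ideal.ofList (fList n d p ++ [(∏ ℓ ∈ Finset.Icc 1 n, xv n ℓ) * xv n j]) := by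
  rw [IDnj_eq_sup, Ideal.ofList_append, Ideal.ofList_singleton, sup_comm]

lemma xv_mul_mem_IDnj {f : MvPolynomial (Fin n) ℝ} (hf : f ∈ IDn n d p) :
    xv n j * f ∈ IDnj n d p j := by
  rw [IDn_eq_sup] at hf
  obtain ⟨u, hu, v, hv, rfl⟩ := Submodule.mem_sup.mp hf
  obtain ⟨c, rfl⟩ := Ideal.mem_span_singleton'.mp hu
  rw [IDnj_eq_sup, mul_add]
  refine add_mem (Ideal.mem_sup_left (Ideal.mem_span_singleton'.mpr ⟨c, by ring⟩))
    (Ideal.mem_sup_right (Ideal.mul_mem_left _ _ hv))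

variable {d p}

lemma mem_IDn_of_xv_mul_mem (hn : 1 ≤ n)
    (hart : FiniteDimensional ℝ (MvPolynomial (Fin n) ℝ ⧸ IDnj n d p j))
    {f : MvPolynomial (Fin n) ℝ} (hf : xv n j * f ∈ IDnj n d p j) : f ∈ IDn n d p := by
  rw [IDnj_eq_sup] at hf
  obtain ⟨u, hu, v, hv, huv⟩ := Submodule.mem_sup.mp hf
  obtain ⟨c, rfl⟩ := Ideal.mem_span_singleton'.mp hu
  rw [IDnj_eq_ofList] at hart
  set h : MvPolynomial (Fin n) ℝ := ∏ ℓ ∈ Finset.Icc 1 n, xv n ℓ with hh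
  have hmem : f - c * h ∈ Ideal.ofList (fList n d p) := by
    refine mem_ofList_of_mul_mem (fList n d p) (h * xv n j) ?_ ?_ ?_ ?_ hart ?_
    · simp only [fList, List.length_map, List.length_range']
      omega
    · intro f hf
      obtain ⟨i, hi, rfl⟩ := (mem_fList d p).mp hf
      exact ⟨_, fDd_isHomogeneous d p hi.1⟩
    · intro f hf
      obtain ⟨i, hi, rfl⟩ := (mem_fList d p).mp hf
      exact constantCoeff_fDd d p hi.1 hi.2
    · rw [map_mul, constantCoeff_xv, mul_zero]
    · have : h * xv n j * (f - c * h) = h * v := by linear_combination -h * huv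
      rw [this]
      exact Ideal.mul_mem_left _ _ hv
  rw [IDn_eq_sup, ← hh]
  exact Submodule.mem_sup.mpr
    ⟨c * h, Ideal.mem_span_singleton'.mpr ⟨c, rfl⟩, f - c * h, hmem, by ring⟩

/-- If `R^{D_(n)}(1)` is finite dimensional, then `f_1` does not vanish at `x_1 = 0`. -/
lemma dropLast_ne_zero (hn : 2 ≤ n)
    (hart : FiniteDimensional ℝ (MvPolynomial (Fin n) ℝ ⧸ IDnj n d p 1)) :
    dropLast d p 1 0 ≠ 0 := by
  intro h0
  have hf1 : fDd n d p 1 ∈ Ideal.span {xv n 1} := by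
    rw [← dropVar_eq_zero_iff le_rfl (by omega), dropVar_fDd_succ d p le_rfl le_rfl (by omega), h0]
    simp
  set l : List (MvPolynomial (Fin n) ℝ) := xv n 1 :: (List.range' 2 (n - 2)).map (fDd n d p)
    with hl
  have hxv : Ideal.span {xv n 1} ≤ Ideal.ofList l := by
    rw [hl, Ideal.ofList_cons]
    exact le_sup_left
  have hle : IDnj n d p 1 ≤ Ideal.ofList l := by
    rw [IDnj, Ideal.span_le, Set.insert_subset_iff]
    refine ⟨hxv (Ideal.mem_span_singleton'.mpr ⟨_, rfl⟩), ?_⟩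
    rintro _ ⟨i, hi, rfl⟩
    obtain rfl | hi1 := eq_or_ne i 1
    · exact hxv hf1
    · refine Ideal.subset_span (List.mem_cons_of_mem _ (List.mem_map.mpr ⟨i, ?_, rfl⟩))
      rw [List.mem_range'_1]
      have := hi.1
      have := hi.2
      omega
  refine not_finiteDimensional_quotient_ofList l ?_ ?_
    (Module.Finite.of_surjective (Ideal.Quotient.factorₐ ℝ hle).toLinearMap
      (Ideal.Quotient.factor_surjective hle))
  · intro f hf
    obtain rfl | hf := List.mem_cons.mp hf
    · exact constantCoeff_xv _ _
    · obtain ⟨i, hi, rfl⟩ := List.mem_map.mp hf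
      rw [List.mem_range'_1] at hi
      exact constantCoeff_fDd d p (by omega) (by omega)
  · simp only [hl, List.length_cons, List.length_map, List.length_range']
    omega

lemma map_dropVar_IDnj (hn : 2 ≤ n) (hj : 1 ≤ j) (hjn : j ≤ n)
    (hart : FiniteDimensional ℝ (MvPolynomial (Fin n) ℝ ⧸ IDnj n d p j)) :
    (IDnj n d p j).map (dropVar n j) =
      IBD (n - 1) d (dropCoeff d j) (dropLast d p j) j := by
  have hsucc : ∀ i, 1 ≤ i → j ≤ i + 1 → i + 1 < n →
      dropVar n j (fDd n d p (i + 1)) = fDd (n - 1) (dropCoeff d j) (dropLast d p j) i := by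
    intro i hi hij hin
    rw [dropVar_fDd_succ d p hj hij hin, fDd, if_neg (by omega)]
  have hone : j = 1 → ∃ c : ℝ, c ≠ 0 ∧ dropVar n j (fDd n d p 1) =
      c • fDd (n - 1) (dropCoeff d j) (dropLast d p j) 0 := by
    rintro rfl
    refine ⟨(-1 : ℝ) ^ (n - 1 - 0 + 1) * (dropLast d p 1 0 : ℝ), mul_ne_zero (by simp) ?_, ?_⟩
    · exact_mod_cast dropLast_ne_zero hn hart
    · rw [dropVar_fDd_succ d p le_rfl le_rfl (by omega), fDd, if_pos rfl]
      simp
  apply le_antisymm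
  · rw [IDnj, Ideal.map_span, Ideal.span_le]
    rintro _ ⟨f, hf, rfl⟩
    obtain rfl | ⟨i, hi, rfl⟩ := hf
    · simp only [map_mul, dropVar_xv_self, mul_zero, SetLike.mem_coe, zero_mem]
    · obtain ⟨hi1, hin⟩ := Set.mem_Icc.mp hi
      simp only [SetLike.mem_coe]
      obtain hij | hij := lt_or_ge i j
      · rw [dropVar_fDd_of_lt d p hi1 hij hjn]
        exact Ideal.subset_span (Or.inl ⟨i, Set.mem_Icc.mpr ⟨hi1, by omega⟩, rfl⟩)
      · have hmem : fDd (n - 1) (dropCoeff d j) (dropLast d p j) (i - 1) ∈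
            IBD (n - 1) d (dropCoeff d j) (dropLast d p j) j :=
          Ideal.subset_span (Or.inr ⟨i, Set.mem_Icc.mpr ⟨hij, hin⟩, rfl⟩)
        obtain rfl | hi2 := eq_or_ne i 1
        · obtain ⟨c, -, hc⟩ := hone (by omega)
          rw [hc]
          exact Submodule.smul_of_tower_mem _ c hmem
        · obtain ⟨i, rfl⟩ : ∃ m, i = m + 1 := ⟨i - 1, by omega⟩
          rwa [hsucc i (by omega) hij (by omega)]
  · rw [IBD, Ideal.span_le]
    have hgen : ∀ i, 1 ≤ i → i ≤ n - 1 →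
        dropVar n j (fDd n d p i) ∈ (IDnj n d p j).map (dropVar n j) := fun i hi hin =>
      Ideal.mem_map_of_mem _ (Ideal.subset_span (Or.inr ⟨i, Set.mem_Icc.mpr ⟨hi, hin⟩, rfl⟩))
    rintro _ (⟨i, hi, rfl⟩ | ⟨i, hi, rfl⟩) <;> obtain ⟨hi1, hin⟩ := Set.mem_Icc.mp hi <;>
      simp only [SetLike.mem_coe]
    · rw [← dropVar_fDd_of_lt d p hi1 (show i < j by omega) hjn]
      exact hgen i hi1 (by omega)
    · obtain rfl | hi2 := eq_or_ne i 1
      · obtain ⟨c, hc0, hc⟩ := hone (by omega)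
        rw [Nat.sub_self, ← inv_smul_smul₀ hc0 (fDd (n - 1) _ _ 0), ← hc]
        exact Submodule.smul_of_tower_mem _ _ (hgen 1 le_rfl hin)
      · obtain ⟨i, rfl⟩ : ∃ m, i = m + 1 := ⟨i - 1, by omega⟩
        rw [Nat.add_sub_cancel, ← hsucc i (by omega) hi1 (by omega)]
        exact hgen _ (by omega) hin

end ExactSequence

/-- **The exact sequence (5.24).** If `R^{D_(n)}(j)` is Artinian, multiplication by `x_j`
induces a well-defined injective ℝ-linear map `R^{D_(n)} → R^{D_(n)}(j)`, whose cokernel is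
isomorphic to a ring `R^{(B'_{(n−1)},D'_{(n−1)})}(j)` in `n−1` variables; i.e. there is a
short exact sequence `0 → R^{D_(n)} → R^{D_(n)}(j) → R^{(B'_{(n−1)},D'_{(n−1)})}(j) → 0`. -/
theorem stmt_11 (n : ℕ) (hn : 2 ≤ n) (d : ℕ → ℕ → ℚ) (p : ℕ → ℚ) (j : ℕ)
    (hj1 : 1 ≤ j) (hjn : j ≤ n)
    (hart : FiniteDimensional ℝ (MvPolynomial (Fin n) ℝ ⧸ IDnj n d p j)) :
    ∃ (b' : ℕ → ℕ → ℚ) (d' : ℕ → ℕ → ℚ) (p' : ℕ → ℚ),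
      ∃ (φ : (MvPolynomial (Fin n) ℝ ⧸ IDn n d p) →ₗ[ℝ]
            (MvPolynomial (Fin n) ℝ ⧸ IDnj n d p j))
        (ψ : (MvPolynomial (Fin n) ℝ ⧸ IDnj n d p j) →ₐ[ℝ]
            (MvPolynomial (Fin (n - 1)) ℝ ⧸ IBD (n - 1) b' d' p' j)),
        (∀ f : MvPolynomial (Fin n) ℝ,
          φ (Ideal.Quotient.mk (IDn n d p) f) =
            Ideal.Quotient.mk (IDnj n d p j) (xv n j * f)) ∧
        Function.Injective φ ∧
        Function.Surjective ψ ∧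
        LinearMap.range φ = LinearMap.ker ψ.toLinearMap := by
  have hmap := map_dropVar_IDnj hn hj1 hjn hart
  have hdrop : Function.Surjective (dropVar n j) := fun g => ⟨_, dropVar_skipVar hj1 hjn g⟩
  set J := IBD (n - 1) d (dropCoeff d j) (dropLast d p j) j
  let φ : (MvPolynomial (Fin n) ℝ ⧸ IDn n d p) →ₗ[ℝ] (MvPolynomial (Fin n) ℝ ⧸ IDnj n d p j) :=
    (Submodule.mapQ (IDn n d p) (IDnj n d p j)
      (LinearMap.mulLeft (MvPolynomial (Fin n) ℝ) (xv n j))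
      fun _ hf => xv_mul_mem_IDnj d p hf).restrictScalars ℝ
  have hφ : ∀ f : MvPolynomial (Fin n) ℝ, φ (Ideal.Quotient.mk (IDn n d p) f) =
      Ideal.Quotient.mk (IDnj n d p j) (xv n j * f) := fun _ => rfl
  let ψ : (MvPolynomial (Fin n) ℝ ⧸ IDnj n d p j) →ₐ[ℝ] (MvPolynomial (Fin (n - 1)) ℝ ⧸ J) :=
    Ideal.quotientMapₐ J (dropVar n j) (Ideal.map_le_iff_le_comap.mp hmap.le)
  have hψ : ∀ f : MvPolynomial (Fin n) ℝ, ψ (Ideal.Quotient.mk (IDnj n d p j) f) =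
      Ideal.Quotient.mk J (dropVar n j f) := fun _ => rfl
  refine ⟨d, dropCoeff d j, dropLast d p j, φ, ψ, hφ, ?_, ?_, ?_⟩
  · rw [injective_iff_map_eq_zero]
    intro a ha
    obtain ⟨f, rfl⟩ := Ideal.Quotient.mk_surjective a
    rw [hφ, Ideal.Quotient.eq_zero_iff_mem] at ha
    exact Ideal.Quotient.eq_zero_iff_mem.mpr (mem_IDn_of_xv_mul_mem (by omega) hart ha)
  · intro b
    obtain ⟨g, rfl⟩ := Ideal.Quotient.mk_surjective b
    obtain ⟨f, rfl⟩ := hdrop g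
    exact ⟨_, hψ f⟩
  · ext a
    rw [LinearMap.mem_range, LinearMap.mem_ker, AlgHom.toLinearMap_apply]
    constructor
    · rintro ⟨b, rfl⟩
      obtain ⟨f, rfl⟩ := Ideal.Quotient.mk_surjective b
      rw [hφ, hψ, map_mul, dropVar_xv_self, zero_mul, map_zero]
    · intro ha
      obtain ⟨f, rfl⟩ := Ideal.Quotient.mk_surjective a
      rw [hψ, Ideal.Quotient.eq_zero_iff_mem, ← hmap,
        Ideal.mem_map_iff_of_surjective _ hdrop] at ha
      obtain ⟨g, hg, hgf⟩ := ha
      have hmem : f - g ∈ Ideal.span {xv n j} := by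
        rw [← dropVar_eq_zero_iff hj1 hjn, map_sub, hgf, sub_self]
      obtain ⟨c, hc⟩ := Ideal.mem_span_singleton'.mp hmem
      refine ⟨Ideal.Quotient.mk _ c, ?_⟩
      rw [hφ, Ideal.Quotient.eq, mul_comm, hc, sub_sub_cancel_left]
      exact neg_mem hg
end
end
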